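/- There is no connected simple graph G on exactly 10 vertices having two longest paths P and Q with V(P) ≠ V(Q) and |V(P) ∩ V(Q)| = 8 such that the subgraph of G induced on V(G) \ (V(P) ∩ V(Q)) is connected. Equivalently, for every connected simple graph G on 10 vertices, if P and Q are longest paths with V(P) ≠ V(Q) and |V(P) ∩ V(Q)| = 8, then V(P) ∩ V(Q) is a separator of G. -/

import Mathlib

open SimpleGraph

/-- `P` is a longest path in the simple graph `G`: it is a path, and every path in `G`
has length at most the length of `P`. -/
def IsLongestPath {V : Type*} (G : SimpleGraph V) {u v : V} (P : G.Walk u v) : Prop :=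
  P.IsPath ∧ ∀ {a b : V} (Q : G.Walk a b), Q.IsPath → Q.length ≤ P.length

section LongestPath

variable {V : Type*} {G : SimpleGraph V} {u v b : V} {P : G.Walk u v}

theorem IsLongestPath.length_le (hP : IsLongestPath G P) {l : List V}
    (hl : l.IsChain G.Adj) (hnd : l.Nodup) : l.length ≤ P.length + 1 := by
  by_cases hne : l = []
  · simp [hne]
  · have h := hP.2 (Walk.ofSupport l hne hl) (by
      rw [Walk.isPath_def, Walk.support_ofSupport]; exact hnd)
    rw [Walk.length_ofSupport] at h
    omega

theorem IsLongestPath.reverse (hP : IsLongestPath G P) : IsLongestPath G P.reverse :=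
  ⟨hP.1.reverse, fun Q hQ => by simpa using hP.2 Q hQ⟩

/-- A vertex `b` outside a longest path cannot be inserted before a reversed segment `[i, j)`. -/
theorem IsLongestPath.not_adj_of_rotation (hP : IsLongestPath G P) (hb : b ∉ P.support) {i j : ℕ}
    (hij : i ≤ j) (hj : j ≤ P.length)
    (hi : ∀ k, k + 1 = i → G.Adj b (P.getVert k)) (hbj : G.Adj b (P.getVert j))
    (h : j < P.length → G.Adj (P.getVert i) (P.getVert (j + 1))) : False := by
  have hc := P.isChain_adj_support
  have hnd := hP.1.support_nodup
  have hlen := P.length_support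
  have hget : ∀ k ≤ P.length, P.support[k]? = some (P.getVert k) := fun k hk =>
    (P.getVert_eq_support_getElem? hk).symm
  generalize P.support = l at *
  have hperm : (l.take i ++ b :: (((l.take (j + 1)).drop i).reverse ++ l.drop (j + 1))).Perm
      (b :: l) := by
    refine List.perm_middle.trans (List.Perm.cons b ?_)
    refine (((List.reverse_perm _).append_right _).append_left _).trans ?_
    rw [← List.append_assoc]
    have : l.take i = (l.take (j + 1)).take i := by
      rw [List.take_take, min_eq_left (by omega)]
    rw [this, List.take_append_drop, List.take_append_drop]
  have hle := hP.length_le (l := l.take i ++ b ::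
    (((l.take (j + 1)).drop i).reverse ++ l.drop (j + 1))) ?_ ?_
  · rw [hperm.length_eq, List.length_cons, hlen] at hle
    omega
  · rw [List.isChain_append, List.isChain_cons, List.isChain_append, List.isChain_reverse]
    refine ⟨hc.take i, ⟨?_, ?_, hc.drop _, ?_⟩, ?_⟩
    · intro y hy
      simp only [List.head?_append, List.head?_reverse, List.getLast?_drop, List.length_take,
        List.getLast?_take] at hy
      rw [if_neg (by omega), if_neg (by omega), Nat.add_sub_cancel, hget j hj] at hy
      simp only [Option.some_or, Option.mem_some_iff] at hy
      exact hy ▸ hbj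
    · exact ((hc.take _).drop _).imp fun _ _ h => h.symm
    · intro x hx y hy
      rw [List.getLast?_reverse, List.head?_drop, List.getElem?_take, if_pos (by omega),
        hget i (by omega)] at hx
      rw [List.head?_drop] at hy
      obtain hlt | hge := lt_or_ge j P.length
      · rw [hget _ hlt] at hy
        simp only [Option.mem_some_iff] at hx hy
        exact hx ▸ hy ▸ h hlt
      · rw [List.getElem?_eq_none (by omega)] at hy
        simp at hy
    · intro x hx y hy
      rw [List.head?_cons, Option.mem_some_iff] at hy
      rw [List.getLast?_take] at hx
      cases i with
      | zero => simp at hx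
      | succ k =>
        rw [if_neg (by omega), Nat.add_sub_cancel, hget k (by omega)] at hx
        simp only [Option.some_or, Option.mem_some_iff] at hx
        exact hx ▸ hy ▸ (hi k rfl).symm
  · rw [hperm.nodup_iff]
    exact List.nodup_cons.2 ⟨hb, hnd⟩

theorem IsLongestPath.not_adj_start (hP : IsLongestPath G P) (hb : b ∉ P.support) :
    ¬ G.Adj b (P.getVert 0) := fun h =>
  hP.not_adj_of_rotation hb le_rfl (Nat.zero_le _) (by simp) h
    fun h0 => P.adj_getVert_succ h0

theorem IsLongestPath.not_adj_end (hP : IsLongestPath G P) (hb : b ∉ P.support) :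
    ¬ G.Adj b (P.getVert P.length) := fun h =>
  hP.not_adj_of_rotation hb (Nat.zero_le _) le_rfl (by simp) h (by simp)

theorem IsLongestPath.not_adj_succ (hP : IsLongestPath G P) (hb : b ∉ P.support) {i : ℕ}
    (hi : i < P.length) (h : G.Adj b (P.getVert i)) : ¬ G.Adj b (P.getVert (i + 1)) := fun h' =>
  hP.not_adj_of_rotation hb le_rfl hi (fun _ hk => Nat.succ_injective hk ▸ h) h'
    fun h0 => P.adj_getVert_succ h0

/-- The outside vertex `b`, the start of the path and the successors of three neighbours of `b`. -/
def successorSet [DecidableEq V] (P : G.Walk u v) (b : V) (x y z : ℕ) : Finset V :=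
  insert b (({0, x + 1, y + 1, z + 1} : Finset ℕ).image P.getVert)

theorem IsLongestPath.lt_length_of_adj (hP : IsLongestPath G P) (hb : b ∉ P.support) {i : ℕ}
    (hi : i ≤ P.length) (h : G.Adj b (P.getVert i)) : 0 < i ∧ i < P.length := by
  have h0 : i ≠ 0 := by rintro rfl; exact hP.not_adj_start hb h
  have h1 : i ≠ P.length := by rintro rfl; exact hP.not_adj_end hb h
  omega

variable [DecidableEq V] {x y z : ℕ}

theorem IsLongestPath.card_successorSet (hP : IsLongestPath G P) (hb : b ∉ P.support)
    (hx : x < P.length) (hy : y < P.length) (hz : z < P.length)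
    (hxy : x ≠ y) (hxz : x ≠ z) (hyz : y ≠ z) : (successorSet P b x y z).card = 5 := by
  rw [successorSet, Finset.card_insert_of_notMem, Finset.card_image_of_injOn]
  · rw [Finset.card_insert_of_notMem, Finset.card_insert_of_notMem, Finset.card_pair] <;>
      simp <;> omega
  · refine hP.1.getVert_injOn.mono ?_
    intro i hi
    simp only [Finset.coe_insert, Finset.coe_singleton, Set.mem_insert_iff,
      Set.mem_singleton_iff] at hi
    simp only [Set.mem_ofPred_eq]
    omega
  · intro h
    obtain ⟨i, -, rfl⟩ := Finset.mem_image.1 h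
    exact hb (P.getVert_mem_support i)

theorem IsLongestPath.not_adj_of_mem_successorSet (hP : IsLongestPath G P) (hb : b ∉ P.support)
    (hx : x < P.length) (hy : y < P.length) (hz : z < P.length)
    (hbx : G.Adj b (P.getVert x)) (hby : G.Adj b (P.getVert y)) (hbz : G.Adj b (P.getVert z))
    {s t : V} (hs : s ∈ successorSet P b x y z) (ht : t ∈ successorSet P b x y z) :
    ¬ G.Adj s t := by
  have hnbr : ∀ i ∈ ({0, x + 1, y + 1, z + 1} : Finset ℕ),
      i ≤ P.length ∧ ∀ k, k + 1 = i → G.Adj b (P.getVert k) := by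
    intro i hi
    simp only [Finset.mem_insert, Finset.mem_singleton] at hi
    rcases hi with rfl | rfl | rfl | rfl
    · simp
    all_goals
      refine ⟨by omega, fun k hk => ?_⟩
      obtain rfl := Nat.succ_injective hk
      assumption
  have hb_not : ∀ i ∈ ({0, x + 1, y + 1, z + 1} : Finset ℕ), ¬ G.Adj b (P.getVert i) := by
    intro i hi
    obtain ⟨hle, hadj⟩ := hnbr i hi
    cases i with
    | zero => exact hP.not_adj_start hb
    | succ k => exact hP.not_adj_succ hb hle (hadj k rfl)
  have hlt : ∀ i ∈ ({0, x + 1, y + 1, z + 1} : Finset ℕ),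
      ∀ j ∈ ({0, x + 1, y + 1, z + 1} : Finset ℕ), i < j →
      ¬ G.Adj (P.getVert i) (P.getVert j) := by
    intro i hi j hj hij h
    obtain ⟨k, rfl⟩ : ∃ k, j = k + 1 := ⟨j - 1, by omega⟩
    obtain ⟨hle, hadj⟩ := hnbr _ hj
    exact hP.not_adj_of_rotation hb (i := i) (j := k) (by omega) (by omega) (hnbr i hi).2
      (hadj k rfl) fun _ => h
  simp only [successorSet, Finset.mem_insert (a := s), Finset.mem_insert (a := t),
    Finset.mem_image] at hs ht
  rcases hs with rfl | ⟨i, hi, rfl⟩ <;> rcases ht with rfl | ⟨j, hj, rfl⟩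
  · exact G.irrefl
  · exact hb_not j hj
  · exact fun h => hb_not i hi h.symm
  · rcases lt_trichotomy i j with hij | rfl | hij
    · exact hlt i hi j hj hij
    · exact G.irrefl
    · exact fun h => hlt j hj i hi hij h.symm

/-- Five pairwise nonadjacent vertices on a path with nine vertices occupy the even positions. -/
theorem eq_even_positions_of_independent (hP : P.IsPath) (hlen : P.length = 8) {S : Finset V}
    (hcard : S.card = 5) (hsub : ∀ s ∈ S, s ∈ P.support)
    (hind : ∀ s ∈ S, ∀ t ∈ S, ¬ G.Adj s t) :
    S = ({0, 2, 4, 6, 8} : Finset ℕ).image P.getVert := by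
  have key : ∀ T : Finset (Fin 9), T.card = 5 →
      (∀ i : Fin 8, ¬ (i.castSucc ∈ T ∧ i.succ ∈ T)) → T = {0, 2, 4, 6, 8} := by
    decide +kernel
  have hinj : Function.Injective fun i : Fin 9 => P.getVert i := fun i j hij =>
    Fin.ext (hP.getVert_injOn (by simp only [Set.mem_ofPred_eq]; omega)
      (by simp only [Set.mem_ofPred_eq]; omega) hij)
  obtain ⟨T, rfl⟩ : ∃ T : Finset (Fin 9), S = T.image fun i : Fin 9 => P.getVert i := by
    refine ⟨Finset.univ.filter fun i : Fin 9 => P.getVert i ∈ S, ?_⟩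
    ext s
    simp only [Finset.mem_image, Finset.mem_filter, Finset.mem_univ, true_and]
    constructor
    · intro hs
      obtain ⟨n, rfl, hn⟩ := Walk.mem_support_iff_exists_getVert.1 (hsub s hs)
      exact ⟨⟨n, by omega⟩, hs, rfl⟩
    · rintro ⟨i, hi, rfl⟩
      exact hi
  rw [Finset.card_image_of_injective _ hinj] at hcard
  rw [key T hcard]
  · simp
  · rintro i ⟨h1, h2⟩
    refine hind _ (Finset.mem_image_of_mem _ h1) _ (Finset.mem_image_of_mem _ h2) ?_
    simpa using P.adj_getVert_succ (i := i) (by omega)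

end LongestPath

/-- Two adjacent vertices cannot be the unique vertices missed by two longest paths of
length eight. -/
theorem not_adj_of_missed {V : Type*} {G : SimpleGraph V} {u₁ v₁ u₂ v₂ a b : V}
    {P : G.Walk u₁ v₁} {Q : G.Walk u₂ v₂} (hP : IsLongestPath G P) (hQ : IsLongestPath G Q)
    (hlP : P.length = 8) (hlQ : Q.length = 8) (hbP : b ∉ P.support) (haQ : a ∉ Q.support)
    (hP' : ∀ w, w ≠ b → w ∈ P.support) (hQ' : ∀ w, w ≠ a → w ∈ Q.support) : ¬ G.Adj a b := by
  classical
  intro hab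
  obtain ⟨k, hk, hk8⟩ := Walk.mem_support_iff_exists_getVert.1 (hQ' b hab.ne')
  obtain ⟨hk0, hk1⟩ := hQ.lt_length_of_adj haQ hk8 (hk ▸ hab)
  obtain ⟨m, rfl⟩ : ∃ m, k = m + 1 := ⟨k - 1, by omega⟩
  have hm : G.Adj b (Q.getVert m) := hk ▸ (Q.adj_getVert_succ (by omega)).symm
  have hm' : G.Adj b (Q.getVert (m + 2)) := hk ▸ Q.adj_getVert_succ hk1
  have hmm : Q.getVert m ≠ Q.getVert (m + 2) := fun h => by
    have := hQ.1.getVert_injOn (by simp only [Set.mem_ofPred_eq]; omega)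
      (by simp only [Set.mem_ofPred_eq]; omega) h
    omega
  obtain ⟨x, hx, hx8⟩ := Walk.mem_support_iff_exists_getVert.1 (hP' a hab.ne)
  obtain ⟨y, hy, hy8⟩ := Walk.mem_support_iff_exists_getVert.1 (hP' _ hm.ne')
  obtain ⟨z, hz, hz8⟩ := Walk.mem_support_iff_exists_getVert.1 (hP' _ hm'.ne')
  have hbx : G.Adj b (P.getVert x) := hx ▸ hab.symm
  rw [← hy] at hm hmm
  rw [← hz] at hm' hmm
  have hya : P.getVert y ≠ a := fun h => haQ (h ▸ hy ▸ Q.getVert_mem_support m)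
  have hza : P.getVert z ≠ a := fun h => haQ (h ▸ hz ▸ Q.getVert_mem_support (m + 2))
  have hxy : x ≠ y := by rintro rfl; exact hya hx
  have hxz : x ≠ z := by rintro rfl; exact hza hx
  have hyz : y ≠ z := by rintro rfl; exact hmm rfl
  have hx1 := hP.lt_length_of_adj hbP hx8 hbx
  have hy1 := hP.lt_length_of_adj hbP hy8 hm
  have hz1 := hP.lt_length_of_adj hbP hz8 hm'
  have even : ∀ {u v : V} {R : G.Walk u v} {i j k : ℕ}, IsLongestPath G R → b ∉ R.support →
      i < R.length → j < R.length → k < R.length → i ≠ j → i ≠ k → j ≠ k →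
      R.getVert i = a → G.Adj b (R.getVert j) → G.Adj b (R.getVert k) →
      successorSet R b i j k = ({0, 2, 4, 6, 8} : Finset ℕ).image Q.getVert := by
    intro u v R i j k hR hbR hi hj hk hij hik hjk hia hbj hbk
    have hbi : G.Adj b (R.getVert i) := hia ▸ hab.symm
    have hind := fun s hs t ht => hR.not_adj_of_mem_successorSet hbR hi hj hk hbi hbj hbk
      (s := s) (t := t) hs ht
    refine eq_even_positions_of_independent hQ.1 hlQ
      (hR.card_successorSet hbR hi hj hk hij hik hjk) (fun s hs => hQ' s ?_) hind
    rintro rfl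
    exact hind b (Finset.mem_insert_self _ _) s hs hab.symm
  have h1 := even hP hbP hx1.2 hy1.2 hz1.2 hxy hxz hyz hx hm hm'
  have h2 := even (i := 8 - x) (j := 8 - y) (k := 8 - z) hP.reverse (by simpa using hbP)
    (by rw [Walk.length_reverse]; omega) (by rw [Walk.length_reverse]; omega)
    (by rw [Walk.length_reverse]; omega) (by omega) (by omega) (by omega)
    (by rw [Walk.getVert_reverse, hlP, Nat.sub_sub_self (by omega)]; exact hx)
    (by rw [Walk.getVert_reverse, hlP, Nat.sub_sub_self (by omega)]; exact hm)
    (by rw [Walk.getVert_reverse, hlP, Nat.sub_sub_self (by omega)]; exact hm')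
  have mem : ∀ i ≤ 8, P.getVert (8 - i) ∈ successorSet P b x y z →
      8 - i = 0 ∨ 8 - i = x + 1 ∨ 8 - i = y + 1 ∨ 8 - i = z + 1 := by
    intro i hi h
    rcases Finset.mem_insert.1 h with h | h
    · exact absurd (h ▸ P.getVert_mem_support _) hbP
    · obtain ⟨j, hj, hji⟩ := Finset.mem_image.1 h
      simp only [Finset.mem_insert, Finset.mem_singleton] at hj
      have := hP.1.getVert_injOn (by simp only [Set.mem_ofPred_eq]; omega)
        (by simp only [Set.mem_ofPred_eq]; omega) hji
      omega
  have pred : ∀ i ∈ ({0, 8 - x + 1, 8 - y + 1, 8 - z + 1} : Finset ℕ),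
      P.getVert (8 - i) ∈ successorSet P b x y z := by
    intro i hi
    rw [h1, ← h2, ← hlP, ← Walk.getVert_reverse]
    rw [hlP]
    exact Finset.mem_insert_of_mem (Finset.mem_image_of_mem _ hi)
  have e0 := mem 0 (by omega) (pred 0 (by simp))
  have ex := mem (8 - x + 1) (by omega) (pred _ (by simp))
  have ey := mem (8 - y + 1) (by omega) (pred _ (by simp))
  have ez := mem (8 - z + 1) (by omega) (pred _ (by simp))
  omega

/-- for every connected simple graph `G` on 10 vertices, if `P` and `Q`
are longest paths with `V(P) ≠ V(Q)` and `|V(P) ∩ V(Q)| = 8`, then `V(P) ∩ V(Q)` is a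
separator of `G`, i.e. the subgraph induced on its complement is not connected. -/
theorem statement5 {V : Type*} [Fintype V] (G : SimpleGraph V)
    (hG : G.Connected) (hcard : Fintype.card V = 10)
    {u₁ v₁ u₂ v₂ : V} (P : G.Walk u₁ v₁) (Q : G.Walk u₂ v₂)
    (hP : IsLongestPath G P) (hQ : IsLongestPath G Q)
    (hne : {x | x ∈ P.support} ≠ {x | x ∈ Q.support})
    (hint : ({x | x ∈ P.support} ∩ {x | x ∈ Q.support}).ncard = 8) :
    ¬ (G.induce ({x | x ∈ P.support} ∩ {x | x ∈ Q.support})ᶜ).Connected := by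
  classical
  intro hconn
  have hncard : ∀ {u v : V} {R : G.Walk u v}, R.IsPath →
      {x | x ∈ R.support}.ncard = R.length + 1 := by
    intro u v R hR
    rw [← Walk.length_support, ← List.toFinset_card_of_nodup hR.support_nodup,
      ← Set.ncard_coe_finset, List.coe_toFinset]
  have hlen : P.length = Q.length := le_antisymm (hQ.2 P hP.1) (hP.2 Q hQ.1)
  have hcP := hncard hP.1
  have hcQ := hncard hQ.1
  set A := {x | x ∈ P.support} with hA
  set B := {x | x ∈ Q.support} with hB
  have hunion := Set.ncard_union_add_ncard_inter A B
  have hle : (A ∪ B).ncard ≤ 10 := by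
    rw [← hcard, ← Nat.card_eq_fintype_card]; exact Set.ncard_le_card _
  have hne7 : P.length ≠ 7 := by
    intro h7
    have h1 : A ∩ B = A := Set.eq_of_subset_of_ncard_le Set.inter_subset_left (by omega)
    have h2 : A ∩ B = B := Set.eq_of_subset_of_ncard_le Set.inter_subset_right (by omega)
    exact hne (h1.symm.trans h2)
  have hge : (A ∩ B).ncard ≤ A.ncard := Set.ncard_le_ncard Set.inter_subset_left
  have hlP : P.length = 8 := by omega
  have hlQ : Q.length = 8 := by omega
  have hcA := Set.ncard_add_ncard_compl A
  have hcB := Set.ncard_add_ncard_compl B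
  rw [Nat.card_eq_fintype_card, hcard] at hcA hcB
  obtain ⟨b, hb⟩ := Set.ncard_eq_one.1 (show Aᶜ.ncard = 1 by omega)
  obtain ⟨a, ha⟩ := Set.ncard_eq_one.1 (show Bᶜ.ncard = 1 by omega)
  have hbA : ∀ w, w ∉ P.support ↔ w = b := fun w => Set.ext_iff.1 hb w
  have haB : ∀ w, w ∉ Q.support ↔ w = a := fun w => Set.ext_iff.1 ha w
  have hab : a ≠ b := by
    rintro rfl
    exact hne (compl_injective (hb.trans ha.symm))
  have hmem : ∀ w, w ∈ (A ∩ B)ᶜ ↔ w = b ∨ w = a := fun w => by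
    rw [Set.compl_inter, hb, ha]; rfl
  have hnontriv : Nontrivial ↥((A ∩ B)ᶜ) :=
    ⟨⟨a, (hmem a).2 (Or.inr rfl)⟩, ⟨b, (hmem b).2 (Or.inl rfl)⟩,
      fun h => hab (congrArg Subtype.val h)⟩
  obtain ⟨⟨w, hw⟩, hadj⟩ :=
    hconn.preconnected.exists_adj_of_nontrivial ⟨a, (hmem a).2 (Or.inr rfl)⟩
  have hadj' : G.Adj a w := hadj
  obtain rfl : w = b := ((hmem w).1 hw).resolve_right hadj'.ne'
  exact not_adj_of_missed hP hQ hlP hlQ ((hbA w).2 rfl) ((haB a).2 rfl)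
    (fun t ht => not_not.1 fun h => ht ((hbA t).1 h))
    (fun t ht => not_not.1 fun h => ht ((haB t).1 h)) hadj'
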